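/- arXiv:0904.0223 — 2 statements merged into one kernel-verified Lean document; each statement's English description precedes it below -/
import Mathlib

section
/- Let d ≥ 1 be an integer, r > 0, and x, y ∈ ℝ^d with ‖x‖ ≤ ‖y‖. Then vol(B(0, r) ∩ B(y, r)) ≤ vol(B(0, r) ∩ B(x, r)); in particular, the Lebesgue measure of the intersection of two closed balls of equal radius r depends only on the distance between their centers and is nonincreasing in that distance. -/
open Metric MeasureTheory

/-- Shrinking the displacement between the centers of two balls of equal radius does not decrease
the measure of their intersection: a translate of the old intersection lies in the new one. -/
theorem measure_closedBall_inter_le_smul {E : Type*} [NormedAddCommGroup E] [NormedSpace ℝ E]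
    [MeasurableSpace E] [BorelSpace E] (μ : Measure E) [μ.IsAddRightInvariant] (r : ℝ) (y : E)
    {t : ℝ} (ht₀ : 0 ≤ t) (ht₁ : t ≤ 1) :
    μ (closedBall 0 r ∩ closedBall y r) ≤ μ (closedBall 0 r ∩ closedBall (t • y) r) := by
  rw [← measure_preimage_add_right μ (((t - 1) / 2) • y) (closedBall 0 r ∩ closedBall (t • y) r)]
  refine measure_mono fun z hz => ?_
  have hz₀ : z ∈ closedBall (0 : E) r := hz.1
  have hzy : z - y ∈ closedBall (0 : E) r := by
    simpa [dist_eq_norm] using hz.2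
  have hconv := convex_closedBall (0 : E) r
  constructor
  · convert hconv hz₀ hzy (a := (1 + t) / 2) (b := (1 - t) / 2) (by linarith) (by linarith)
      (by ring) using 1
    module
  · rw [mem_closedBall, dist_eq_norm, ← mem_closedBall_zero_iff]
    convert hconv hz₀ hzy (a := (1 - t) / 2) (b := (1 + t) / 2) (by linarith) (by linarith)
      (by ring) using 1
    module

/-- The volume of the intersection of two balls of equal radius depends only on the distance
between their centers. -/
theorem volume_closedBall_inter_eq_of_norm_eq {E : Type*} [NormedAddCommGroup E]
    [InnerProductSpace ℝ E] [FiniteDimensional ℝ E] [MeasurableSpace E] [BorelSpace E] (r : ℝ)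
    {x y : E} (h : ‖x‖ = ‖y‖) :
    volume (closedBall 0 r ∩ closedBall x r) = volume (closedBall 0 r ∩ closedBall y r) := by
  let f := (ℝ ∙ (x - y))ᗮ.reflection
  have hf : f x = y := Submodule.reflection_sub h
  have hpre := f.measurePreserving.measure_preimage_equiv (f := f.toMeasurableEquiv)
    (closedBall 0 r ∩ closedBall y r)
  rw [← hpre, Set.preimage_inter]
  congr 2
  · ext z
    simp
  · ext z
    simp [← hf]

theorem lens_volume_antitone (d : ℕ) (hd : 1 ≤ d) (r : ℝ) (hr : 0 < r)
    (x y : EuclideanSpace ℝ (Fin d)) (hxy : ‖x‖ ≤ ‖y‖) :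
    volume (closedBall (0 : EuclideanSpace ℝ (Fin d)) r ∩ closedBall y r) ≤
      volume (closedBall (0 : EuclideanSpace ℝ (Fin d)) r ∩ closedBall x r) := by
  obtain ⟨w, hw, t, ht₀, ht₁, rfl⟩ : ∃ w : EuclideanSpace ℝ (Fin d), ‖y‖ = ‖w‖ ∧
      ∃ t : ℝ, 0 ≤ t ∧ t ≤ 1 ∧ x = t • w := by
    rcases eq_or_ne x 0 with rfl | hx
    · exact ⟨y, rfl, 0, le_rfl, zero_le_one, by simp⟩
    · have hx' : 0 < ‖x‖ := norm_pos_iff.mpr hx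
      have hy' : 0 < ‖y‖ := hx'.trans_le hxy
      refine ⟨(‖y‖ / ‖x‖) • x, ?_, ‖x‖ / ‖y‖, by positivity, div_le_one_of_le₀ hxy hy'.le, ?_⟩
      · rw [norm_smul, norm_div, norm_norm, norm_norm, div_mul_cancel₀ _ hx'.ne']
      · rw [smul_smul, div_mul_div_cancel₀ hy'.ne', div_self hx'.ne', one_smul]
  rw [volume_closedBall_inter_eq_of_norm_eq r hw]
  exact measure_closedBall_inter_le_smul volume r w ht₀ ht₁
end

section
/- Let d ≥ 2 be an integer and c > 0. Then for every a > (1 + c^{1/d}/2)^d one has a·η(a, c) > 1, and (1 + c^{1/d}/2)^d · η((1 + c^{1/d}/2)^d, c) ≥ 1. Consequently α(c) ≤ (1 + c^{1/d}/2)^d. -/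
open Metric MeasureTheory

/-- The intersection of two closed balls of radius `r` centered at `0` and `x` contains
the closed ball of radius `r - ‖x‖ / 2` centered at the midpoint. -/
theorem closedBall_half_smul_subset_inter {E : Type*} [NormedAddCommGroup E] [NormedSpace ℝ E]
    (x : E) (r : ℝ) :
    closedBall ((1 / 2 : ℝ) • x) (r - ‖x‖ / 2) ⊆ closedBall 0 r ∩ closedBall x r := by
  refine Set.subset_inter (closedBall_subset_closedBall' ?_) (closedBall_subset_closedBall' ?_)
  · rw [dist_zero_right, norm_smul]
    norm_num
    linarith
  · have h : (1 / 2 : ℝ) • x - x = (-(1 / 2) : ℝ) • x := by module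
    rw [dist_eq_norm, h, norm_smul]
    norm_num
    linarith

theorem pow_sub_half_norm_mul_le_volume_inter {d : ℕ} (x : EuclideanSpace ℝ (Fin d)) {r : ℝ}
    (hr : ‖x‖ / 2 ≤ r) :
    (r - ‖x‖ / 2) ^ d * (volume (closedBall (0 : EuclideanSpace ℝ (Fin d)) 1)).toReal ≤
      (volume (closedBall 0 r ∩ closedBall x r)).toReal := by
  have h := Measure.addHaar_closedBall' volume ((1 / 2 : ℝ) • x) (sub_nonneg.2 hr)
  rw [finrank_euclideanSpace_fin] at h
  have hfin : volume (closedBall (0 : EuclideanSpace ℝ (Fin d)) r ∩ closedBall x r) ≠ ⊤ :=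
    measure_ne_top_of_subset Set.inter_subset_left measure_closedBall_lt_top.ne
  have hle := ENNReal.toReal_mono hfin (measure_mono (closedBall_half_smul_subset_inter x r))
  rwa [h, ENNReal.toReal_mul,
    ENNReal.toReal_ofReal (pow_nonneg (sub_nonneg.2 hr) d)] at hle

/-- The bound `(a ^ (1 / d) - ‖x‖ / 2) ^ d ≤ a * η`, where `η` is the fraction of the volume of
a ball of radius `a ^ (1 / d)` that is covered by its translate by `x`. -/
theorem pow_sub_half_norm_le_mul_overlap {d : ℕ} (x : EuclideanSpace ℝ (Fin d)) {a : ℝ}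
    (ha : 0 < a) (hx : ‖x‖ / 2 ≤ a ^ ((d : ℝ)⁻¹)) :
    (a ^ ((d : ℝ)⁻¹) - ‖x‖ / 2) ^ d ≤ a *
      ((volume (closedBall (0 : EuclideanSpace ℝ (Fin d)) (a ^ ((d : ℝ)⁻¹)) ∩
        closedBall x (a ^ ((d : ℝ)⁻¹)))).toReal /
      ((volume (closedBall (0 : EuclideanSpace ℝ (Fin d)) 1)).toReal * a)) := by
  have hθ : 0 < (volume (closedBall (0 : EuclideanSpace ℝ (Fin d)) 1)).toReal :=
    ENNReal.toReal_pos (measure_closedBall_pos _ _ one_pos).ne' measure_closedBall_lt_top.ne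
  rw [← div_div, mul_div_cancel₀ _ ha.ne', le_div_iff₀ hθ]
  exact pow_sub_half_norm_mul_le_volume_inter x hx

theorem alpha_upper_bound (d : ℕ) (hd : 2 ≤ d) (c : ℝ) (hc : 0 < c) :
    (∀ a : ℝ, (1 + c ^ ((d : ℝ)⁻¹) / 2) ^ d < a →
      1 < a *
        ((volume (closedBall (0 : EuclideanSpace ℝ (Fin d)) (a ^ ((d : ℝ)⁻¹)) ∩
          closedBall ((c ^ ((d : ℝ)⁻¹)) • EuclideanSpace.single (⟨0, by omega⟩ : Fin d) (1 : ℝ))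
            (a ^ ((d : ℝ)⁻¹)))).toReal /
        ((volume (closedBall (0 : EuclideanSpace ℝ (Fin d)) 1)).toReal * a))) ∧
    1 ≤ (1 + c ^ ((d : ℝ)⁻¹) / 2) ^ d *
        ((volume (closedBall (0 : EuclideanSpace ℝ (Fin d))
            (((1 + c ^ ((d : ℝ)⁻¹) / 2) ^ d) ^ ((d : ℝ)⁻¹)) ∩
          closedBall ((c ^ ((d : ℝ)⁻¹)) • EuclideanSpace.single (⟨0, by omega⟩ : Fin d) (1 : ℝ))
            (((1 + c ^ ((d : ℝ)⁻¹) / 2) ^ d) ^ ((d : ℝ)⁻¹)))).toReal /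
        ((volume (closedBall (0 : EuclideanSpace ℝ (Fin d)) 1)).toReal *
          (1 + c ^ ((d : ℝ)⁻¹) / 2) ^ d)) ∧
    sInf {a : ℝ | 0 < a ∧
      1 < a *
        ((volume (closedBall (0 : EuclideanSpace ℝ (Fin d)) (a ^ ((d : ℝ)⁻¹)) ∩
          closedBall ((c ^ ((d : ℝ)⁻¹)) • EuclideanSpace.single (⟨0, by omega⟩ : Fin d) (1 : ℝ))
            (a ^ ((d : ℝ)⁻¹)))).toReal /
        ((volume (closedBall (0 : EuclideanSpace ℝ (Fin d)) 1)).toReal * a))} ≤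
      (1 + c ^ ((d : ℝ)⁻¹) / 2) ^ d := by
  have hd0 : d ≠ 0 := by omega
  have ht : 0 < c ^ ((d : ℝ)⁻¹) := Real.rpow_pos_of_pos hc _
  set t := c ^ ((d : ℝ)⁻¹)
  have hb : 0 < (1 + t / 2) ^ d := by positivity
  have hroot : ((1 + t / 2) ^ d) ^ ((d : ℝ)⁻¹) = 1 + t / 2 :=
    Real.pow_rpow_inv_natCast (by positivity) hd0
  have hnorm : ‖t • EuclideanSpace.single (⟨0, by omega⟩ : Fin d) (1 : ℝ)‖ = t := by
    simp [norm_smul, abs_of_pos ht]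
  have key := fun (a : ℝ) (ha : 0 < a) => pow_sub_half_norm_le_mul_overlap
    (t • EuclideanSpace.single (⟨0, by omega⟩ : Fin d) (1 : ℝ)) ha
  simp only [hnorm] at key
  have hlt : ∀ a : ℝ, (1 + t / 2) ^ d < a → 1 < a *
      ((volume (closedBall (0 : EuclideanSpace ℝ (Fin d)) (a ^ ((d : ℝ)⁻¹)) ∩
        closedBall (t • EuclideanSpace.single (⟨0, by omega⟩ : Fin d) (1 : ℝ))
          (a ^ ((d : ℝ)⁻¹)))).toReal /
      ((volume (closedBall (0 : EuclideanSpace ℝ (Fin d)) 1)).toReal * a)) := by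
    intro a ha
    have hr : 1 + t / 2 < a ^ ((d : ℝ)⁻¹) := by
      rw [← hroot]
      exact Real.rpow_lt_rpow hb.le ha (by positivity)
    exact (one_lt_pow₀ (by linarith) hd0).trans_le (key a (hb.trans ha) (by linarith))
  refine ⟨hlt, ?_, ?_⟩
  · have h := key _ hb (by rw [hroot]; linarith)
    rwa [show ((1 + t / 2) ^ d) ^ ((d : ℝ)⁻¹) - t / 2 = 1 by rw [hroot]; ring, one_pow] at h
  · refine le_of_forall_gt_imp_ge_of_dense fun a ha => ?_
    exact csInf_le ⟨0, fun _ h => h.1.le⟩ ⟨hb.trans ha, hlt a ha⟩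
end
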